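/- arXiv:0810.3136 — 2 statements merged into one kernel-verified Lean document; each statement's English description precedes it below -/
import Mathlib

section
/- Let φ be a 3CNF formula over variables α₁, …, α_n with clauses c₁, …, c_m in which some clause contains at least two literals, let K(φ) be the associated graph game, and let x be the imputation assigning payoff 1 to player sat and 0 to every other player. Then for each player i of K(φ) with i ∉ {sat, chall}, max_{S ∈ I_{i,sat}} e(S, x) ≤ max_{S ∈ I_{sat,i}} e(S, x). -/
set_option synthInstance.maxSize 1000
set_option maxHeartbeats 1000000

/-!
The graph game `K(φ)` associated with a 3CNF formula `φ = c₁ ∧ … ∧ c_m` over variables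
`α₁, …, α_n`.  A literal is a pair `(i, b) : Fin n × Bool` (`b = true` for the positive
literal `α_{i+1}`, `b = false` for `¬α_{i+1}`; we use `0`-based indices, so the paper's
variable `α_i` is index `i - 1` and its paper weight `2^i` becomes `2^(i+1)` here).
A clause is the finset of its literals, so `φ` is given by `c : Fin m → Finset (Fin n × Bool)`.

Players: a variable player for each variable, a clause player for each clause, a literal
player for each occurrence of a literal in a clause, and the special players `chall`
(encoded by `false`) and `sat` (encoded by `true`).
-/

/-- Literal occurrences: a literal together with a clause it occurs in. -/
abbrev KLit (n m : ℕ) (c : Fin m → Finset (Fin n × Bool)) :=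
  {p : (Fin n × Bool) × Fin m // p.1 ∈ c p.2}

/-- The players of the graph game `K(φ)`. -/
abbrev KP (n m : ℕ) (c : Fin m → Finset (Fin n × Bool)) :=
  Fin n ⊕ (Fin m ⊕ (KLit n m c ⊕ Bool))

variable {n m : ℕ} (c : Fin m → Finset (Fin n × Bool))

/-- The variable player `α_i`. -/
def KPvar (i : Fin n) : KP n m c := Sum.inl i
/-- The clause player `c_j`. -/
def KPcl (j : Fin m) : KP n m c := Sum.inr (Sum.inl j)
/-- The literal player `ℓ_{i,j}`. -/
def KPlit (l : KLit n m c) : KP n m c := Sum.inr (Sum.inr (Sum.inl l))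
/-- The player `chall`. -/
def KPchall : KP n m c := Sum.inr (Sum.inr (Sum.inr false))
/-- The player `sat`. -/
def KPsat : KP n m c := Sum.inr (Sum.inr (Sum.inr true))

/-- The (symmetric) edge-weight function of `K(φ)`, excluding the normalizer edge
`{chall, sat}`; `Kw0 c u v = 0` when `{u, v}` is not an edge.
Positive edges: `{c_j, ℓ_{i,j}}` of weight `2^(n+3)`; `{chall, α_i}` of weight `2^(i+1)`;
`{sat, α_i}` of weight `2^(i+1)` plus an extra `2^0` for the first variable.
Penalty edges, of weight `-2^(m+n+7)`: pairs of distinct literal occurrences in the same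
clause, opposite occurrences of the same variable, and `{α_i, ¬α_{i,j}}` for each negative
occurrence of a variable. -/
noncomputable def Kw0 : KP n m c → KP n m c → ℝ := fun u v =>
  match u, v with
  | Sum.inr (Sum.inl j), Sum.inr (Sum.inr (Sum.inl l)) =>
      if l.1.2 = j then (2:ℝ)^(n+3) else 0
  | Sum.inr (Sum.inr (Sum.inl l)), Sum.inr (Sum.inl j) =>
      if l.1.2 = j then (2:ℝ)^(n+3) else 0
  | Sum.inl i, Sum.inr (Sum.inr (Sum.inr b)) =>
      (2:ℝ)^((i:ℕ)+1) + (if b = true ∧ (i:ℕ) = 0 then 1 else 0)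
  | Sum.inr (Sum.inr (Sum.inr b)), Sum.inl i =>
      (2:ℝ)^((i:ℕ)+1) + (if b = true ∧ (i:ℕ) = 0 then 1 else 0)
  | Sum.inr (Sum.inr (Sum.inl l)), Sum.inr (Sum.inr (Sum.inl l')) =>
      if (l.1.2 = l'.1.2 ∧ l.1.1 ≠ l'.1.1) ∨ (l.1.1.1 = l'.1.1.1 ∧ l.1.1.2 ≠ l'.1.1.2)
      then -((2:ℝ)^(m+n+7)) else 0
  | Sum.inl i, Sum.inr (Sum.inr (Sum.inl l)) =>
      if l.1.1 = (i, false) then -((2:ℝ)^(m+n+7)) else 0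
  | Sum.inr (Sum.inr (Sum.inl l)), Sum.inl i =>
      if l.1.1 = (i, false) then -((2:ℝ)^(m+n+7)) else 0
  | _, _ => 0

/-- The weight of the normalizer edge `{chall, sat}`:
`1` minus the sum of the weights of all other edges. -/
noncomputable def Kwnorm : ℝ := 1 - (∑ u : KP n m c, ∑ v : KP n m c, Kw0 c u v) / 2

/-- The full (symmetric) edge-weight function of `K(φ)`. -/
noncomputable def Kw (u v : KP n m c) : ℝ :=
  Kw0 c u v +
    (if (u = KPchall c ∧ v = KPsat c) ∨ (u = KPsat c ∧ v = KPchall c) then Kwnorm c else 0)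

/-- The worth of a coalition `S` in the graph game `K(φ)`: the sum of the weights of all
edges contained in `S` (written via the symmetric weight function). -/
noncomputable def Kworth (S : Finset (KP n m c)) : ℝ := (∑ u ∈ S, ∑ v ∈ S, Kw c u v) / 2

/-- The payoff vector assigning `1` to the player `sat` and `0` to every other player. -/
noncomputable def Kx : KP n m c → ℝ := fun p => if p = KPsat c then 1 else 0

/-- `I_{i,j}`: the coalitions containing `i` but not `j`. -/
def KIset (i j : KP n m c) : Finset (Finset (KP n m c)) :=
  Finset.univ.filter (fun S => i ∈ S ∧ j ∉ S)

/-- The surplus `s_{i,j}(x) = max_{S ∈ I_{i,j}} (v(S) - x(S))`.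
(For `i ≠ j` the singleton `{i}` belongs to `I_{i,j}`, so inserting it does not change
the maximum; it merely makes the maximum well defined for all arguments.) -/
noncomputable def Ksurplus (i j : KP n m c) (x : KP n m c → ℝ) : ℝ :=
  (insert {i} (KIset c i j)).sup' (Finset.insert_nonempty _ _)
    (fun S => Kworth c S - ∑ k ∈ S, x k)

/-- `x` is an imputation: efficient and individually rational. -/
def KIsImputation (x : KP n m c → ℝ) : Prop :=
  (∑ p, x p) = Kworth c Finset.univ ∧ ∀ p, x p ≥ Kworth c {p}

/-- Membership in the kernel of the game `K(φ)`. -/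
def KInKernel (x : KP n m c → ℝ) : Prop :=
  KIsImputation c x ∧
    ∀ i j : KP n m c, i ≠ j → Ksurplus c i j x > Ksurplus c j i x → x j = Kworth c {j}

/-- `σ` is a satisfying assignment for `φ`. -/
def KSat (σ : Fin n → Bool) : Prop := ∀ j : Fin m, ∃ l ∈ c j, σ l.1 = l.2

instance : DecidablePred (KSat c) := fun σ => by unfold KSat; infer_instance

/-- The value `∑_{α_i : σ(α_i) = true} 2^i` of an assignment (with `0`-based indices,
the paper's `2^i` is `2^(i+1)` here). -/
noncomputable def Kval (σ : Fin n → Bool) : ℝ :=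
  ∑ i : Fin n, if σ i then (2:ℝ)^((i:ℕ)+1) else 0

/-- `D`: the maximum worth over all coalitions not containing both `chall` and `sat`. -/
noncomputable def KD : ℝ :=
  ((Finset.univ : Finset (Finset (KP n m c))).filter
      (fun S => ¬ ({KPchall c, KPsat c} ⊆ S))).sup'
    ⟨∅, by simp⟩ (Kworth c)

/-- One orientation of the penalty-edge relation of `K(φ)`. -/
def KPenaltyHalf : KP n m c → KP n m c → Prop := fun u v =>
  (∃ l l' : KLit n m c, u = KPlit c l ∧ v = KPlit c l' ∧
      ((l.1.2 = l'.1.2 ∧ l.1.1 ≠ l'.1.1) ∨ (l.1.1.1 = l'.1.1.1 ∧ l.1.1.2 ≠ l'.1.1.2))) ∨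
  (∃ (i : Fin n) (l : KLit n m c), u = KPvar c i ∧ v = KPlit c l ∧ l.1.1 = (i, false))

/-- `{u, v}` is a penalty edge of `K(φ)`. -/
def KPenalty (u v : KP n m c) : Prop := KPenaltyHalf c u v ∨ KPenaltyHalf c v u

/-- The total positive weight of the edges other than the normalizer, over ordered pairs. -/
noncomputable def Kpos : ℝ := ∑ u : KP n m c, ∑ v : KP n m c, max (Kw0 c u v) 0

theorem sum_special_edges_le (b : Bool) (n : ℕ) :
    ∑ i : Fin n, ((2:ℝ)^((i:ℕ)+1) + (if b = true ∧ (i:ℕ) = 0 then 1 else 0)) ≤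
      2^(n+1) - 1 := by
  rw [Fin.sum_univ_eq_sum_range
    (fun i : ℕ => (2:ℝ)^(i+1) + (if b = true ∧ i = 0 then 1 else 0))]
  induction n with
  | zero => norm_num
  | succ k ih =>
    rw [Finset.sum_range_succ]
    rcases Nat.eq_zero_or_pos k with rfl | hk
    · cases b <;> norm_num
    · have hb : ¬ (b = true ∧ k = 0) := by omega
      rw [if_neg hb, pow_succ (2:ℝ) (k+1)]
      linarith

theorem card_KLit_le (h3 : ∀ j, (c j).card ≤ 3) : Fintype.card (KLit n m c) ≤ 3 * m := by
  rw [Fintype.card_subtype, Finset.card_filter, Fintype.sum_prod_type_right]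
  calc ∑ j, ∑ a, (if a ∈ c j then 1 else 0) ≤ ∑ _j : Fin m, 3 :=
        Finset.sum_le_sum fun j _ => by simpa using h3 j
    _ = 3 * m := by simp [mul_comm]

theorem Kpos_le (h3 : ∀ j, (c j).card ≤ 3) : Kpos c ≤ 2^(m+n+7) := by
  have hlit : ∀ (p : Prop) [Decidable p], max (if p then -((2:ℝ)^(m+n+7)) else 0) 0 = 0 := by
    intro p _
    split_ifs <;> simp
  have hcl : ∀ (p : Prop) [Decidable p],
      max (if p then (2:ℝ)^(n+3) else 0) 0 = if p then (2:ℝ)^(n+3) else 0 := by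
    intro p _
    split_ifs <;> simp
  have hvar : ∀ (b : Bool) (i : Fin n),
      max ((2:ℝ)^((i:ℕ)+1) + (if b = true ∧ (i:ℕ) = 0 then 1 else 0)) 0 =
        (2:ℝ)^((i:ℕ)+1) + (if b = true ∧ (i:ℕ) = 0 then 1 else 0) := by
    intro b i
    apply max_eq_left
    split_ifs <;> positivity
  have key : Kpos c =
      2 * (∑ b : Bool, ∑ i : Fin n,
        ((2:ℝ)^((i:ℕ)+1) + (if b = true ∧ (i:ℕ) = 0 then 1 else 0))) +
      2 * (Fintype.card (KLit n m c) * (2:ℝ)^(n+3)) := by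
    have hswap : ∑ j : Fin m, ∑ l : KLit n m c, (if l.1.2 = j then (2:ℝ)^(n+3) else 0) =
        Fintype.card (KLit n m c) * (2:ℝ)^(n+3) := by
      rw [Finset.sum_comm]
      simp only [Finset.sum_ite_eq, Finset.mem_univ, if_true, Finset.sum_const,
        Finset.card_univ, nsmul_eq_mul]
    have hswap' : ∑ l : KLit n m c, ∑ j : Fin m, (if l.1.2 = j then (2:ℝ)^(n+3) else 0) =
        Fintype.card (KLit n m c) * (2:ℝ)^(n+3) := by
      rw [Finset.sum_comm, hswap]
    unfold Kpos
    simp only [Fintype.sum_sum_type, Kw0, hlit, hcl, hvar, max_self, Finset.sum_const_zero,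
      add_zero, zero_add, hswap, hswap']
    rw [Finset.sum_comm (s := (Finset.univ : Finset (Fin n)))]
    ring
  have hL : (Fintype.card (KLit n m c) : ℝ) ≤ 3 * m := mod_cast card_KLit_le c h3
  have hm : (m : ℝ) + 1 ≤ 2^m := mod_cast Nat.lt_two_pow_self (n := m)
  have hn : (0:ℝ) < 2^n := by positivity
  have h1 := sum_special_edges_le true n
  have h2 := sum_special_edges_le false n
  rw [key, Fintype.sum_bool]
  have e1 : (2:ℝ)^(n+1) = 2 * 2^n := by ring
  have e2 : (2:ℝ)^(n+3) = 8 * 2^n := by ring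
  have e3 : (2:ℝ)^(m+n+7) = 128 * 2^m * 2^n := by ring
  rw [e1] at h1 h2
  rw [e2, e3]
  nlinarith [mul_le_mul_of_nonneg_right hL hn.le, mul_le_mul_of_nonneg_right hm hn.le,
    mul_nonneg (Nat.cast_nonneg (α := ℝ) m) hn.le]

theorem Kw0_lit_lit_of_ne {j : Fin m} {a b : Fin n × Bool} (ha : a ∈ c j) (hb : b ∈ c j)
    (hab : a ≠ b) :
    Kw0 c (KPlit c ⟨(a, j), ha⟩) (KPlit c ⟨(b, j), hb⟩) = -((2:ℝ)^(m+n+7)) :=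
  if_pos (Or.inl ⟨rfl, hab⟩)

theorem sum_Kw0_le (h2 : ∃ j, 2 ≤ (c j).card) :
    ∑ u : KP n m c, ∑ v : KP n m c, Kw0 c u v ≤ Kpos c - 2 * 2^(m+n+7) := by
  obtain ⟨j, hj⟩ := h2
  obtain ⟨a, ha, b, hb, hab⟩ := Finset.one_lt_card.mp hj
  have hne : ((KPlit c ⟨(a, j), ha⟩, KPlit c ⟨(b, j), hb⟩) : KP n m c × KP n m c) ≠
      (KPlit c ⟨(b, j), hb⟩, KPlit c ⟨(a, j), ha⟩) := by
    simp [KPlit, hab]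
  have hge := Finset.add_le_sum
    (f := fun p : KP n m c × KP n m c => max (Kw0 c p.1 p.2) 0 - Kw0 c p.1 p.2)
    (fun p _ => sub_nonneg.mpr (le_max_left _ _)) (Finset.mem_univ _) (Finset.mem_univ _) hne
  rw [Fintype.sum_prod_type] at hge
  simp only [Finset.sum_sub_distrib, Kw0_lit_lit_of_ne c ha hb hab,
    Kw0_lit_lit_of_ne c hb ha hab.symm] at hge
  rw [max_eq_right (by simp)] at hge
  unfold Kpos
  linarith

theorem Kworth_le_of_sat_notMem {S : Finset (KP n m c)} (hS : KPsat c ∉ S) :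
    Kworth c S ≤ Kpos c / 2 := by
  unfold Kworth Kpos
  gcongr
  calc ∑ u ∈ S, ∑ v ∈ S, Kw c u v
      ≤ ∑ u ∈ S, ∑ v ∈ S, max (Kw0 c u v) 0 := by
        refine Finset.sum_le_sum fun u hu => Finset.sum_le_sum fun v hv => ?_
        have h : ¬ ((u = KPchall c ∧ v = KPsat c) ∨ (u = KPsat c ∧ v = KPchall c)) := by
          rintro (⟨_, rfl⟩ | ⟨rfl, _⟩) <;> contradiction
        rw [Kw, if_neg h, add_zero]
        exact le_max_left _ _
    _ ≤ ∑ u ∈ S, ∑ v, max (Kw0 c u v) 0 :=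
        Finset.sum_le_sum fun u _ => Finset.sum_le_sum_of_subset_of_nonneg
          (Finset.subset_univ _) fun _ _ _ => le_max_right _ _
    _ ≤ ∑ u, ∑ v, max (Kw0 c u v) 0 :=
        Finset.sum_le_sum_of_subset_of_nonneg (Finset.subset_univ _)
          fun _ _ _ => Finset.sum_nonneg fun _ _ => le_max_right _ _

theorem Kworth_chall_sat : Kworth c {KPchall c, KPsat c} = Kwnorm c := by
  have h : KPchall c ≠ KPsat c := by simp [KPchall, KPsat]
  simp [Kworth, Finset.sum_pair h, Kw, h, h.symm]
  simp [Kw0, KPchall, KPsat]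

theorem sum_Kx (S : Finset (KP n m c)) :
    ∑ k ∈ S, Kx c k = if KPsat c ∈ S then 1 else 0 := by
  simp [Kx]

/--
**No player other than `chall` outweighs `sat`.**
Let `φ` be a 3CNF formula in which some clause contains at least two literals, and let `x`
be the imputation of `K(φ)` assigning `1` to `sat` and `0` to every other player.
Then for each player `i ∉ {sat, chall}`,
`max_{S ∈ I_{i,sat}} e(S, x) ≤ max_{S ∈ I_{sat,i}} e(S, x)`.
-/
theorem K_surplus_against_sat (n m : ℕ)
    (c : Fin m → Finset (Fin n × Bool))
    (h3 : ∀ j, (c j).card ≤ 3) (h2 : ∃ j, 2 ≤ (c j).card) :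
    ∀ i : KP n m c, i ≠ KPsat c → i ≠ KPchall c →
      Ksurplus c i (KPsat c) (Kx c) ≤ Ksurplus c (KPsat c) i (Kx c) := by
  intro i hsat hchall
  have hle : Kpos c / 2 ≤ Kwnorm c - 1 := by
    have h := sum_Kw0_le c h2
    have h' := Kpos_le c h3
    unfold Kwnorm
    linarith
  have hmem : ({KPchall c, KPsat c} : Finset (KP n m c)) ∈
      insert {KPsat c} (KIset c (KPsat c) i) := by
    simp [KIset, hsat, hchall]
  refine le_trans ?_ (Finset.le_sup' (fun S => Kworth c S - ∑ k ∈ S, Kx c k) hmem)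
  refine Finset.sup'_le _ _ fun S hS => ?_
  have hS' : KPsat c ∉ S := by
    rcases Finset.mem_insert.mp hS with rfl | hS
    · simpa using hsat.symm
    · exact (Finset.mem_filter.mp hS).2.2
  have hw := Kworth_le_of_sat_notMem c hS'
  rw [sum_Kx, if_neg hS', sum_Kx, if_pos (by simp), Kworth_chall_sat]
  linarith
end

section
/- Let φ be a satisfiable 3CNF formula over variables α₁, …, α_n with clauses c₁, …, c_m in which some clause contains at least two literals, let K(φ) be the associated graph game, and let x be the imputation assigning payoff 1 to player sat and 0 to every other player. Then max_{S ∈ I_{sat,chall}} e(S, x) = m·2^{n+3} + max over satisfying assignments σ of φ of ( [σ(α₁)=true] + Σ_{α_i : σ(α_i)=true} 2^i ) − 1, where [σ(α₁)=true] equals 1 if α₁ evaluates to true in σ and 0 otherwise. -/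
set_option synthInstance.maxSize 1000
set_option maxHeartbeats 1000000

variable {n m : ℕ} (c : Fin m → Finset (Fin n × Bool))

/-- The weight of the edge `{sat, α_i}`. -/
noncomputable def KsatWeight (i : Fin n) : ℝ := (2:ℝ)^((i:ℕ)+1) + (if (i:ℕ) = 0 then 1 else 0)

lemma KsatWeight_nonneg (i : Fin n) : 0 ≤ KsatWeight i := by
  unfold KsatWeight; positivity

lemma sum_KsatWeight_le (n : ℕ) : ∑ i : Fin n, KsatWeight i ≤ (2:ℝ)^(n+1) := by
  unfold KsatWeight
  rw [Fin.sum_univ_eq_sum_range (fun i => (2:ℝ)^(i+1) + (if i = 0 then (1:ℝ) else 0)) n,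
    Finset.sum_add_distrib, Finset.sum_ite_eq' (Finset.range n) 0 (fun _ => (1:ℝ))]
  have h : ∑ i ∈ Finset.range n, (2:ℝ)^(i+1) = 2^(n+1) - 2 := by
    induction n with
    | zero => simp
    | succ k ih => rw [Finset.sum_range_succ, ih]; ring
  rw [h]
  split_ifs <;> linarith

lemma indicator_add_Kval (hn : 0 < n) (σ : Fin n → Bool) :
    (if σ ⟨0, hn⟩ = true then (1:ℝ) else 0) + Kval σ =
      ∑ i, if σ i = true then KsatWeight i else 0 := by
  have h : (if σ ⟨0, hn⟩ = true then (1:ℝ) else 0) =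
      ∑ i : Fin n, if σ i = true then (if (i:ℕ) = 0 then (1:ℝ) else 0) else 0 := by
    rw [Finset.sum_eq_single ⟨0, hn⟩]
    · simp
    · intro b _ hb
      have : (b:ℕ) ≠ 0 := fun h => hb (Fin.ext h)
      simp [this]
    · simp
  rw [h, Kval, ← Finset.sum_add_distrib]
  refine Finset.sum_congr rfl fun i _ => ?_
  unfold KsatWeight
  split_ifs <;> ring

/-- The penalty relation between two literal occurrences. -/
abbrev KConflict (l l' : KLit n m c) : Prop :=
  (l.1.2 = l'.1.2 ∧ l.1.1 ≠ l'.1.1) ∨ (l.1.1.1 = l'.1.1.1 ∧ l.1.1.2 ≠ l'.1.1.2)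

/-- The number of literal players of the clause `c_j` in `S`, provided `c_j` belongs to `S`. -/
noncomputable def KclauseCount (S : Finset (KP n m c)) (j : Fin m) : ℝ :=
  ∑ l : KLit n m c, if KPcl c j ∈ S ∧ KPlit c l ∈ S ∧ l.1.2 = j then 1 else 0

/-- The number of ordered pairs of conflicting literal players in `S`. -/
noncomputable def KlitConflicts (S : Finset (KP n m c)) : ℝ :=
  ∑ l : KLit n m c, ∑ l' : KLit n m c,
    if KPlit c l ∈ S ∧ KPlit c l' ∈ S ∧ KConflict c l l' then 1 else 0

/-- The number of penalty edges in `S` between a variable player and a literal player. -/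
noncomputable def KvarConflicts (S : Finset (KP n m c)) : ℝ :=
  ∑ i : Fin n, ∑ l : KLit n m c,
    if KPvar c i ∈ S ∧ KPlit c l ∈ S ∧ l.1.1 = (i, false) then 1 else 0

lemma Kworth_eq (S : Finset (KP n m c)) (hs : KPsat c ∈ S) (hc : KPchall c ∉ S) :
    Kworth c S = (2:ℝ)^(n+3) * ∑ j, KclauseCount c S j
      + (∑ i, if KPvar c i ∈ S then KsatWeight i else 0)
      - (2:ℝ)^(m+n+7) * (KlitConflicts c S / 2 + KvarConflicts c S) := by
  have h0 : ∑ u ∈ S, ∑ v ∈ S, Kw c u v = ∑ u ∈ S, ∑ v ∈ S, Kw0 c u v := by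
    refine Finset.sum_congr rfl fun u hu => Finset.sum_congr rfl fun v hv => ?_
    have h1 : u ≠ KPchall c := fun h => hc (h ▸ hu)
    have h2 : v ≠ KPchall c := fun h => hc (h ▸ hv)
    simp [Kw, h1, h2]
  have h1 : ∑ u ∈ S, ∑ v ∈ S, Kw0 c u v =
      ∑ u, ∑ v, if u ∈ S ∧ v ∈ S then Kw0 c u v else 0 := by
    simp only [ite_and, Finset.sum_ite_irrel, Finset.sum_const_zero, Finset.sum_ite_mem,
      Finset.univ_inter]
  have hsat : (Sum.inr (Sum.inr (Sum.inr true)) : KP n m c) ∈ S := hs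
  have hchall : (Sum.inr (Sum.inr (Sum.inr false)) : KP n m c) ∉ S := hc
  have hcl : ∑ j : Fin m, ∑ l : KLit n m c,
      (if KPcl c j ∈ S ∧ KPlit c l ∈ S then (if l.1.2 = j then (2:ℝ)^(n+3) else 0) else 0) =
      (2:ℝ)^(n+3) * ∑ j, KclauseCount c S j := by
    simp only [KclauseCount, Finset.mul_sum, mul_ite, mul_one, mul_zero, ← ite_and, and_assoc]
  have hcl' : ∑ l : KLit n m c, ∑ j : Fin m,
      (if KPlit c l ∈ S ∧ KPcl c j ∈ S then (if l.1.2 = j then (2:ℝ)^(n+3) else 0) else 0) =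
      (2:ℝ)^(n+3) * ∑ j, KclauseCount c S j := by
    rw [Finset.sum_comm, ← hcl]
    simp only [and_comm]
  have hvar : ∑ i : Fin n, ∑ l : KLit n m c,
      (if KPvar c i ∈ S ∧ KPlit c l ∈ S then
        (if l.1.1 = (i, false) then -(2:ℝ)^(m+n+7) else 0) else 0) =
      -((2:ℝ)^(m+n+7) * KvarConflicts c S) := by
    rw [← neg_mul]
    simp only [KvarConflicts, Finset.mul_sum, mul_ite, mul_one, mul_zero, ← ite_and, and_assoc]
  have hvar' : ∑ l : KLit n m c, ∑ i : Fin n,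
      (if KPlit c l ∈ S ∧ KPvar c i ∈ S then
        (if l.1.1 = (i, false) then -(2:ℝ)^(m+n+7) else 0) else 0) =
      -((2:ℝ)^(m+n+7) * KvarConflicts c S) := by
    rw [Finset.sum_comm, ← hvar]
    simp only [and_comm]
  have hlit : ∑ l : KLit n m c, ∑ l' : KLit n m c,
      (if KPlit c l ∈ S ∧ KPlit c l' ∈ S then
        (if KConflict c l l' then -(2:ℝ)^(m+n+7) else 0) else 0) =
      -((2:ℝ)^(m+n+7) * KlitConflicts c S) := by
    rw [← neg_mul]
    simp only [KlitConflicts, Finset.mul_sum, mul_ite, mul_one, mul_zero, ← ite_and, and_assoc]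
  have hw : ∑ i : Fin n, (if KPvar c i ∈ S then
      ((2:ℝ)^((i:ℕ)+1) + (if (i:ℕ) = 0 then 1 else 0)) else 0) =
      ∑ i, if KPvar c i ∈ S then KsatWeight i else 0 := rfl
  have h2 : ∑ u, ∑ v, (if u ∈ S ∧ v ∈ S then Kw0 c u v else 0) =
      2 * ((2:ℝ)^(n+3) * ∑ j, KclauseCount c S j)
      + 2 * (∑ i, if KPvar c i ∈ S then KsatWeight i else 0)
      + 2 * -((2:ℝ)^(m+n+7) * KvarConflicts c S) + -((2:ℝ)^(m+n+7) * KlitConflicts c S) := by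
    rw [two_mul, two_mul, two_mul]
    nth_rewrite 1 [← hcl]
    rw [← hcl', ← hw, ← hlit]
    nth_rewrite 1 [← hvar]
    rw [← hvar']
    simp only [KPvar, KPcl, KPlit]
    simp only [Fintype.sum_sum_type, Fintype.sum_bool, Kw0, Finset.sum_add_distrib]
    simp [hsat, hchall]
    ring_nf
  rw [Kworth, h0, h1, h2]
  ring

lemma KclauseCount_eq_card (S : Finset (KP n m c)) (j : Fin m) :
    KclauseCount c S j = ((Finset.univ.filter fun l : KLit n m c =>
      KPcl c j ∈ S ∧ KPlit c l ∈ S ∧ l.1.2 = j).card : ℝ) := by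
  rw [KclauseCount, Finset.sum_boole]

lemma KclauseCount_le_card (S : Finset (KP n m c)) (j : Fin m) :
    KclauseCount c S j ≤ (c j).card := by
  rw [KclauseCount_eq_card]
  refine Nat.cast_le.2 (Finset.card_le_card_of_injOn (fun l => l.1.1) ?_ ?_)
  · intro l hl
    have hl' := (Finset.mem_filter.1 hl).2.2.2
    exact hl' ▸ l.2
  · intro l hl l' hl' h
    have h1 := (Finset.mem_filter.1 hl).2.2.2
    have h2 := (Finset.mem_filter.1 hl').2.2.2
    exact Subtype.ext (Prod.ext h (h1.trans h2.symm))

lemma KlitConflicts_nonneg (S : Finset (KP n m c)) : 0 ≤ KlitConflicts c S :=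
  Finset.sum_nonneg fun _ _ => Finset.sum_nonneg fun _ _ => by split_ifs <;> norm_num

lemma KvarConflicts_nonneg (S : Finset (KP n m c)) : 0 ≤ KvarConflicts c S :=
  Finset.sum_nonneg fun _ _ => Finset.sum_nonneg fun _ _ => by split_ifs <;> norm_num

lemma one_le_KlitConflicts {S : Finset (KP n m c)} {l l' : KLit n m c} (hl : KPlit c l ∈ S)
    (hl' : KPlit c l' ∈ S) (h : KConflict c l l') : 1 ≤ KlitConflicts c S := by
  calc (1:ℝ) = if KPlit c l ∈ S ∧ KPlit c l' ∈ S ∧ KConflict c l l' then 1 else 0 :=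
        (if_pos ⟨hl, hl', h⟩).symm
    _ ≤ ∑ l' : KLit n m c,
          if KPlit c l ∈ S ∧ KPlit c l' ∈ S ∧ KConflict c l l' then (1:ℝ) else 0 :=
        Finset.single_le_sum (f := fun l' : KLit n m c =>
          if KPlit c l ∈ S ∧ KPlit c l' ∈ S ∧ KConflict c l l' then (1:ℝ) else 0)
          (fun _ _ => by split_ifs <;> norm_num) (Finset.mem_univ l')
    _ ≤ KlitConflicts c S :=
        Finset.single_le_sum (f := fun l : KLit n m c => ∑ l' : KLit n m c,
          if KPlit c l ∈ S ∧ KPlit c l' ∈ S ∧ KConflict c l l' then (1:ℝ) else 0)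
          (fun _ _ => Finset.sum_nonneg fun _ _ => by split_ifs <;> norm_num) (Finset.mem_univ l)

lemma one_le_KvarConflicts {S : Finset (KP n m c)} {i : Fin n} {l : KLit n m c}
    (hi : KPvar c i ∈ S) (hl : KPlit c l ∈ S) (h : l.1.1 = (i, false)) :
    1 ≤ KvarConflicts c S := by
  calc (1:ℝ) = if KPvar c i ∈ S ∧ KPlit c l ∈ S ∧ l.1.1 = (i, false) then 1 else 0 :=
        (if_pos ⟨hi, hl, h⟩).symm
    _ ≤ ∑ l : KLit n m c,
          if KPvar c i ∈ S ∧ KPlit c l ∈ S ∧ l.1.1 = (i, false) then (1:ℝ) else 0 :=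
        Finset.single_le_sum (f := fun l : KLit n m c =>
          if KPvar c i ∈ S ∧ KPlit c l ∈ S ∧ l.1.1 = (i, false) then (1:ℝ) else 0)
          (fun _ _ => by split_ifs <;> norm_num) (Finset.mem_univ l)
    _ ≤ KvarConflicts c S :=
        Finset.single_le_sum (f := fun i : Fin n => ∑ l : KLit n m c,
          if KPvar c i ∈ S ∧ KPlit c l ∈ S ∧ l.1.1 = (i, false) then (1:ℝ) else 0)
          (fun _ _ => Finset.sum_nonneg fun _ _ => by split_ifs <;> norm_num) (Finset.mem_univ i)

/-- A coalition containing a penalty edge has nonpositive worth. -/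
lemma Kworth_nonpos (h3 : ∀ j, (c j).card ≤ 3) (S : Finset (KP n m c)) (hs : KPsat c ∈ S)
    (hc : KPchall c ∉ S) (h : 1 ≤ KlitConflicts c S ∨ 1 ≤ KvarConflicts c S) :
    Kworth c S ≤ 0 := by
  have hV : (∑ i, if KPvar c i ∈ S then KsatWeight i else 0) ≤ (2:ℝ)^(n+1) :=
    (Finset.sum_le_sum fun i _ => by split_ifs <;> simp [KsatWeight_nonneg]).trans
      (sum_KsatWeight_le n)
  have hC : ∑ j, KclauseCount c S j ≤ 3 * m := by
    calc ∑ j, KclauseCount c S j ≤ ∑ _j : Fin m, (3:ℝ) := Finset.sum_le_sum fun j _ =>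
          (KclauseCount_le_card c S j).trans (by exact_mod_cast h3 j)
      _ = 3 * m := by simp [mul_comm]
  have hP : 1 / 2 ≤ KlitConflicts c S / 2 + KvarConflicts c S := by
    have := KlitConflicts_nonneg c S
    have := KvarConflicts_nonneg c S
    rcases h with h | h <;> linarith
  have hm : (m:ℝ) + 1 ≤ 2^m := by exact_mod_cast Nat.lt_two_pow_self (n := m)
  have hn : (0:ℝ) < 2^n := by positivity
  rw [Kworth_eq c S hs hc]
  have e1 : (2:ℝ)^(n+3) * ∑ j, KclauseCount c S j ≤ 2^(n+3) * (3 * m) := by gcongr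
  have e2 : (2:ℝ)^(m+n+7) * (1/2) ≤
      2^(m+n+7) * (KlitConflicts c S / 2 + KvarConflicts c S) := by gcongr
  have e3 : (2:ℝ)^(n+3) * (3 * m) + 2^(n+1) ≤ 2^(m+n+7) * (1/2) := by
    have e4 : (2:ℝ)^n * (m + 1) ≤ 2^n * 2^m := by gcongr
    have e5 : 0 ≤ (2:ℝ)^n * m := by positivity
    rw [pow_add, pow_add, pow_add, pow_add]
    nlinarith
  linarith

/-- Every coalition containing `sat` but not `chall` is bounded by a satisfying assignment. -/
lemma exists_KSat_Kworth_le (h3 : ∀ j, (c j).card ≤ 3) (hsat : ∃ σ, KSat c σ)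
    (S : Finset (KP n m c)) (hs : KPsat c ∈ S) (hc : KPchall c ∉ S) :
    ∃ σ, KSat c σ ∧ Kworth c S ≤
      (m:ℝ) * (2:ℝ)^(n+3) + ∑ i, if σ i = true then KsatWeight i else 0 := by
  have hnonneg : ∀ σ : Fin n → Bool, 0 ≤ ∑ i, if σ i = true then KsatWeight i else 0 :=
    fun σ => Finset.sum_nonneg fun i _ => by split_ifs <;> simp [KsatWeight_nonneg]
  by_cases hpen : 1 ≤ KlitConflicts c S ∨ 1 ≤ KvarConflicts c S
  · obtain ⟨σ, hσ⟩ := hsat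
    refine ⟨σ, hσ, (Kworth_nonpos c h3 S hs hc hpen).trans (add_nonneg (by positivity) (hnonneg σ))⟩
  push Not at hpen
  have hlit : ∀ l l' : KLit n m c, KPlit c l ∈ S → KPlit c l' ∈ S → ¬ KConflict c l l' :=
    fun l l' hl hl' h => hpen.1.not_ge (one_le_KlitConflicts c hl hl' h)
  have hvar : ∀ (i : Fin n) (l : KLit n m c), KPvar c i ∈ S → KPlit c l ∈ S →
      l.1.1 ≠ (i, false) := fun i l hi hl h => hpen.2.not_ge (one_le_KvarConflicts c hi hl h)
  have hone : ∀ j, KclauseCount c S j ≤ 1 := by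
    intro j
    rw [KclauseCount_eq_card]
    refine Nat.cast_le_one.2 (Finset.card_le_one.2 fun l hl l' hl' => ?_)
    obtain ⟨-, -, hl, hlj⟩ := Finset.mem_filter.1 hl
    obtain ⟨-, -, hl', hlj'⟩ := Finset.mem_filter.1 hl'
    by_contra hne
    exact hlit l l' hl hl' (Or.inl ⟨hlj.trans hlj'.symm,
      fun h => hne (Subtype.ext (Prod.ext h (hlj.trans hlj'.symm)))⟩)
  have hw : Kworth c S ≤ (2:ℝ)^(n+3) * ∑ j, KclauseCount c S j
      + (∑ i, if KPvar c i ∈ S then KsatWeight i else 0) := by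
    rw [Kworth_eq c S hs hc]
    have := KlitConflicts_nonneg c S
    have := KvarConflicts_nonneg c S
    have : 0 ≤ (2:ℝ)^(m+n+7) * (KlitConflicts c S / 2 + KvarConflicts c S) := by positivity
    linarith
  by_cases hall : ∀ j, ∃ l : KLit n m c, KPlit c l ∈ S ∧ l.1.2 = j
  · classical
    let σ : Fin n → Bool := fun i =>
      decide (KPvar c i ∈ S ∨ ∃ l : KLit n m c, KPlit c l ∈ S ∧ l.1.1 = (i, true))
    refine ⟨σ, ?_, hw.trans (add_le_add ?_ ?_)⟩
    · intro j
      obtain ⟨l, hl, rfl⟩ := hall j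
      refine ⟨l.1.1, l.2, ?_⟩
      rcases hb : l.1.1 with ⟨i, b⟩
      cases b
      · refine decide_eq_false ?_
        rintro (hi | ⟨l', hl', h⟩)
        · exact hvar i l hi hl hb
        · exact hlit l l' hl hl' (Or.inr (by simp [hb, h]))
      · exact decide_eq_true (Or.inr ⟨l, hl, hb⟩)
    · have : ∑ j, KclauseCount c S j ≤ m :=
        (Finset.sum_le_sum fun j _ => hone j).trans (by simp)
      rw [mul_comm]
      gcongr
    · refine Finset.sum_le_sum fun i _ => ?_
      by_cases hi : KPvar c i ∈ S
      · have : σ i = true := decide_eq_true (Or.inl hi)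
        rw [if_pos hi, if_pos this]
      · rw [if_neg hi]
        split_ifs <;> simp [KsatWeight_nonneg]
  · push Not at hall
    obtain ⟨j₀, hj₀⟩ := hall
    obtain ⟨σ, hσ⟩ := hsat
    refine ⟨σ, hσ, ?_⟩
    have hzero : KclauseCount c S j₀ = 0 :=
      Finset.sum_eq_zero fun l _ => if_neg fun h => hj₀ l h.2.1 h.2.2
    have hC : ∑ j, KclauseCount c S j ≤ m - 1 := by
      have : ∑ j, KclauseCount c S j ≤ ∑ j : Fin m, if j = j₀ then (0:ℝ) else 1 := by
        refine Finset.sum_le_sum fun j _ => ?_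
        split_ifs with h
        · rw [h, hzero]
        · exact hone j
      refine this.trans (le_of_eq ?_)
      have h1 : ∀ j : Fin m, (if j = j₀ then (0:ℝ) else 1) = 1 - if j = j₀ then 1 else 0 :=
        fun j => by split_ifs <;> norm_num
      simp [h1]
    have hV : (∑ i, if KPvar c i ∈ S then KsatWeight i else 0) ≤ (2:ℝ)^(n+1) :=
      (Finset.sum_le_sum fun i _ => by split_ifs <;> simp [KsatWeight_nonneg]).trans
        (sum_KsatWeight_le n)
    have e1 : (2:ℝ)^(n+3) * ∑ j, KclauseCount c S j ≤ 2^(n+3) * (m - 1) := by gcongr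
    have e2 : (2:ℝ)^(n+1) ≤ 2^(n+3) := pow_le_pow_right₀ (by norm_num) (by lia)
    linarith [hnonneg σ]

/-- Every satisfying assignment yields a coalition containing `sat` but not `chall`. -/
lemma exists_Kworth_eq (σ : Fin n → Bool) (hσ : KSat c σ) :
    ∃ S : Finset (KP n m c), KPsat c ∈ S ∧ KPchall c ∉ S ∧ Kworth c S =
      (m:ℝ) * (2:ℝ)^(n+3) + ∑ i, if σ i = true then KsatWeight i else 0 := by
  classical
  choose L hL hσL using hσ
  let S : Finset (KP n m c) := Finset.univ.filter
    (Sum.elim (fun i => σ i = true) (Sum.elim (fun _ => True)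
      (Sum.elim (fun l => l.1.1 = L l.1.2) (fun b => b = true))))
  have hvar : ∀ i, KPvar c i ∈ S ↔ σ i = true := fun i => by simp [S, KPvar]
  have hcl : ∀ j, KPcl c j ∈ S := fun j => by simp [S, KPcl]
  have hlit : ∀ l, KPlit c l ∈ S ↔ l.1.1 = L l.1.2 := fun l => by simp [S, KPlit]
  have hs : KPsat c ∈ S := by simp [S, KPsat]
  have hc : KPchall c ∉ S := by simp [S, KPchall]
  have htrue : ∀ l, KPlit c l ∈ S → σ l.1.1.1 = l.1.1.2 := fun l hl => by
    rw [(hlit l).1 hl]; exact hσL _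
  refine ⟨S, hs, hc, ?_⟩
  have hcount : ∀ j, KclauseCount c S j = 1 := by
    intro j
    rw [KclauseCount, Finset.sum_eq_single ⟨(L j, j), hL j⟩]
    · exact if_pos ⟨hcl j, (hlit _).2 rfl, rfl⟩
    · rintro l - hne
      refine if_neg ?_
      rintro ⟨-, hl, rfl⟩
      exact hne (Subtype.ext (Prod.ext ((hlit l).1 hl) rfl))
    · exact fun h => absurd (Finset.mem_univ _) h
  have hA : KlitConflicts c S = 0 := by
    refine Finset.sum_eq_zero fun l _ => Finset.sum_eq_zero fun l' _ => if_neg ?_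
    rintro ⟨hl, hl', ⟨h, hne⟩ | ⟨h, hne⟩⟩
    · exact hne (by rw [(hlit l).1 hl, (hlit l').1 hl', h])
    · exact hne (by rw [← htrue l hl, ← htrue l' hl', h])
  have hB : KvarConflicts c S = 0 := by
    refine Finset.sum_eq_zero fun i _ => Finset.sum_eq_zero fun l _ => if_neg ?_
    rintro ⟨hi, hl, h⟩
    have h1 := htrue l hl
    rw [h] at h1
    exact Bool.false_ne_true (h1.symm.trans ((hvar i).1 hi))
  rw [Kworth_eq c S hs hc, hA, hB]
  simp [hcount, hvar, mul_comm]

/--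
**The maximum excess of `sat` against `chall`.**
Let `φ` be a satisfiable 3CNF formula (some clause having at least two literals) and `x`
the imputation of `K(φ)` assigning `1` to `sat` and `0` to every other player.  Then
`max_{S ∈ I_{sat,chall}} e(S, x)
   = m·2^(n+3) + max_{σ ⊨ φ} ([σ(α₁) = true] + ∑_{α_i : σ(α_i)=true} 2^i) − 1`,
where `[σ(α₁) = true]` is `1` if `α₁` evaluates to true in `σ` and `0` otherwise.
-/
theorem K_surplus_sat_chall (n m : ℕ) (hn : 0 < n)
    (c : Fin m → Finset (Fin n × Bool))
    (h3 : ∀ j, (c j).card ≤ 3) (h2 : ∃ j, 2 ≤ (c j).card)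
    (hsat : ∃ σ, KSat c σ) :
    Ksurplus c (KPsat c) (KPchall c) (Kx c) =
      (m : ℝ) * (2:ℝ)^(n+3) +
        (Finset.univ.filter (fun σ => KSat c σ)).sup'
          (by obtain ⟨σ, hσ⟩ := hsat
              exact ⟨σ, Finset.mem_filter.2 ⟨Finset.mem_univ _, hσ⟩⟩)
          (fun σ => (if σ ⟨0, hn⟩ = true then (1:ℝ) else 0) + Kval σ) - 1 := by
  have hx : ∀ S : Finset (KP n m c), KPsat c ∈ S → ∑ k ∈ S, Kx c k = 1 := fun S hS => by
    simp [Kx, hS]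
  have hne : KPchall c ≠ KPsat c := by simp [KPchall, KPsat]
  refine le_antisymm (Finset.sup'_le _ _ fun S hS => ?_) ?_
  · have hS' : KPsat c ∈ S ∧ KPchall c ∉ S := by
      rcases Finset.mem_insert.1 hS with rfl | hS
      · simp [hne]
      · exact (Finset.mem_filter.1 hS).2
    obtain ⟨σ, hσ, hle⟩ := exists_KSat_Kworth_le c h3 hsat S hS'.1 hS'.2
    rw [← indicator_add_Kval hn] at hle
    have := Finset.le_sup' (fun σ => (if σ ⟨0, hn⟩ = true then (1:ℝ) else 0) + Kval σ)
      (Finset.mem_filter.2 ⟨Finset.mem_univ σ, hσ⟩)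
    rw [hx S hS'.1]
    linarith
  · obtain ⟨σ₀, hσ₀⟩ := hsat
    obtain ⟨σ, hσ, heq⟩ := Finset.exists_mem_eq_sup'
      (⟨σ₀, Finset.mem_filter.2 ⟨Finset.mem_univ _, hσ₀⟩⟩ :
        (Finset.univ.filter (fun σ => KSat c σ)).Nonempty)
      (fun σ => (if σ ⟨0, hn⟩ = true then (1:ℝ) else 0) + Kval σ)
    obtain ⟨S, hs, hc, hS⟩ := exists_Kworth_eq c σ (Finset.mem_filter.1 hσ).2
    rw [heq, indicator_add_Kval hn, ← hS, ← hx S hs]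
    exact Finset.le_sup' (fun S => Kworth c S - ∑ k ∈ S, Kx c k)
      (Finset.mem_insert_of_mem (Finset.mem_filter.2 ⟨Finset.mem_univ S, hs, hc⟩))
end
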